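/- arXiv:math/0511260 — 3 statements merged into one kernel-verified Lean document; each statement's English description precedes it below -/
import Mathlib

section
/- A linear map f = f₁∘p₁ + f₂∘p₂ + f₃∘p₃: Λ²(g) → z is a 2-cocycle (i.e. vanishes on B₂(g)) if and only if both f₁∘p₁ + f₂∘p₂ and f₃∘p₃ are 2-cocycles. -/
set_option linter.unusedSectionVars false
set_option synthInstance.maxHeartbeats 1000000
set_option maxHeartbeats 1000000
open scoped TensorProduct

namespace CurrentPaper

variable (K : Type*) [Field K] [CharZero K]

section Wedge

variable (V : Type*) [AddCommGroup V] [Module K V]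

/-- `x ∧ y = (1/2)(x ⊗ y - y ⊗ x)` inside `V ⊗ V`. -/
noncomputable def wedge (x y : V) : V ⊗[K] V := (2 : K)⁻¹ • (x ⊗ₜ[K] y - y ⊗ₜ[K] x)

/-- `x ∨ y = (1/2)(x ⊗ y + y ⊗ x)` inside `V ⊗ V`. -/
noncomputable def vee (x y : V) : V ⊗[K] V := (2 : K)⁻¹ • (x ⊗ₜ[K] y + y ⊗ₜ[K] x)

/-- `Λ²(V)` realized as the subspace of skew-symmetric tensors of `V ⊗ V`. -/
def lambda2 : Submodule K (V ⊗[K] V) := Submodule.span K {t | ∃ x y : V, t = wedge K V x y}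

/-- `S²(V)` realized as the subspace of symmetric tensors of `V ⊗ V`. -/
def sym2 : Submodule K (V ⊗[K] V) := Submodule.span K {t | ∃ x y : V, t = vee K V x y}

variable {V}

lemma wedge_mem (x y : V) : wedge K V x y ∈ lambda2 K V := Submodule.subset_span ⟨x, y, rfl⟩

lemma vee_mem (x y : V) : vee K V x y ∈ sym2 K V := Submodule.subset_span ⟨x, y, rfl⟩

end Wedge

section LieRelaxed

variable (L : Type*) [LieRing L] [Module K L]

/-- `∂(u ∧ v ∧ w) = ⁅u,v⁆ ∧ w + ⁅v,w⁆ ∧ u + ⁅w,u⁆ ∧ v`. -/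
noncomputable def dd (u v w : L) : L ⊗[K] L :=
  wedge K L ⁅u, v⁆ w + wedge K L ⁅v, w⁆ u + wedge K L ⁅w, u⁆ v

/-- `B₂(L)`, the space of 2-boundaries, i.e. the image of `∂ : Λ³(L) → Λ²(L)`. -/
def B2 : Submodule K (L ⊗[K] L) := Submodule.span K {t | ∃ u v w : L, t = dd K L u v w}

variable {L}

lemma dd_mem_lambda2 (u v w : L) : dd K L u v w ∈ lambda2 K L :=
  add_mem (add_mem (wedge_mem K _ _) (wedge_mem K _ _)) (wedge_mem K _ _)

lemma dd_mem_B2 (u v w : L) : dd K L u v w ∈ B2 K L := Submodule.subset_span ⟨u, v, w, rfl⟩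

end LieRelaxed

section Lie

variable (L : Type*) [LieRing L] [LieAlgebra K L]

/-- The bracket `b : L ⊗ L → L`, `u ⊗ v ↦ ⁅u,v⁆`, as a linear map. -/
noncomputable def bracketHom : L ⊗[K] L →ₗ[K] L :=
  TensorProduct.lift (LinearMap.mk₂ K (fun u v => ⁅u, v⁆) add_lie smul_lie lie_add lie_smul)

/-- `Z₂(L) = Λ²(L) ∩ ker b`, the space of 2-cycles. -/
noncomputable def Z2 : Submodule K (L ⊗[K] L) := lambda2 K L ⊓ LinearMap.ker (bracketHom K L)

/-- The derived algebra `L' = [L,L]`, as a subspace of `L`. -/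
def derived : Submodule K L := Submodule.span K {m | ∃ u v : L, m = ⁅u, v⁆}

end Lie

section Alg

variable (A : Type*) [CommRing A] [Algebra K A]

/-- `I_A ⊆ S²(A)`: the kernel of the multiplication map `S²(A) → A`. -/
noncomputable def ia : Submodule K (A ⊗[K] A) := sym2 K A ⊓ LinearMap.ker (LinearMap.mul' K A)

/-- `T(A) ⊆ Λ²(A)`: the span of the elements `ab ∧ c + bc ∧ a + ca ∧ b`. -/
def TA : Submodule K (A ⊗[K] A) :=
  Submodule.span K
    {t | ∃ a b c : A, t = wedge K A (a*b) c + wedge K A (b*c) a + wedge K A (c*a) b}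

/-- `T₀(A) ⊆ Λ²(A)`: the span of the elements `ab ∧ c + bc ∧ a + ca ∧ b - abc ∧ 1`. -/
def T0A : Submodule K (A ⊗[K] A) :=
  Submodule.span K
    {t | ∃ a b c : A,
      t = wedge K A (a*b) c + wedge K A (b*c) a + wedge K A (c*a) b - wedge K A (a*b*c) 1}

variable {A}

lemma TA_el_mem_lambda2 (a b c : A) :
    wedge K A (a*b) c + wedge K A (b*c) a + wedge K A (c*a) b ∈ lambda2 K A :=
  add_mem (add_mem (wedge_mem K _ _) (wedge_mem K _ _)) (wedge_mem K _ _)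

lemma T0A_el_mem_lambda2 (a b c : A) :
    wedge K A (a*b) c + wedge K A (b*c) a + wedge K A (c*a) b - wedge K A (a*b*c) 1 ∈
      lambda2 K A :=
  sub_mem (TA_el_mem_lambda2 K a b c) (wedge_mem K _ _)

lemma ia_el_mem (a b : A) : vee K A a b - vee K A (a * b) 1 ∈ ia K A := by
  refine Submodule.mem_inf.mpr ⟨sub_mem (vee_mem K a b) (vee_mem K _ _), ?_⟩
  simp only [LinearMap.mem_ker, map_sub, vee, map_smul, map_add, LinearMap.mul'_apply,
    mul_one, one_mul, mul_comm b a]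
  simp

end Alg

section Current

variable (A : Type*) [CommRing A] [Algebra K A]
variable (k : Type*) [LieRing k] [LieAlgebra K k]

lemma g_smul_lie (c : K) (x y : A ⊗[K] k) : ⁅c • x, y⁆ = c • ⁅x, y⁆ := by
  rw [← algebraMap_smul A c x, ← algebraMap_smul A c ⁅x, y⁆, smul_lie]

lemma g_lie_smul (c : K) (x y : A ⊗[K] k) : ⁅x, c • y⁆ = c • ⁅x, y⁆ := by
  rw [← algebraMap_smul A c y, ← algebraMap_smul A c ⁅x, y⁆, lie_smul]

/-- The bracket of the current algebra `g = A ⊗ k`, as a `K`-linear map `g ⊗ g → g`. -/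
noncomputable def gBracket : (A ⊗[K] k) ⊗[K] (A ⊗[K] k) →ₗ[K] A ⊗[K] k :=
  TensorProduct.lift (LinearMap.mk₂ K (fun u v => ⁅u, v⁆) add_lie
    (fun c x y => g_smul_lie K A k c x y) lie_add (fun c x y => g_lie_smul K A k c x y))

/-- `Z₂(g) = Λ²(g) ∩ ker b` for the current algebra `g = A ⊗ k`. -/
noncomputable def Z2g : Submodule K ((A ⊗[K] k) ⊗[K] (A ⊗[K] k)) :=
  lambda2 K (A ⊗[K] k) ⊓ LinearMap.ker (gBracket K A k)

/-- The first summand `Λ²(A) ⊗ S²(k)` of the decomposition of `Λ²(A ⊗ k)`. -/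
abbrev M1 := (↥(lambda2 K A)) ⊗[K] (↥(sym2 K k))

/-- The second summand `A ⊗ Λ²(k)` of the decomposition of `Λ²(A ⊗ k)`. -/
abbrev M2 := A ⊗[K] (↥(lambda2 K k))

/-- The third summand `I_A ⊗ Λ²(k)` of the decomposition of `Λ²(A ⊗ k)`. -/
abbrev M3 := (↥(ia K A)) ⊗[K] (↥(lambda2 K k))

/-- The target of the isomorphism `P = (p₁,p₂,p₃)`. -/
abbrev Wspace := M1 K A k × M2 K A k × M3 K A k

variable {A k}

/-- The property characterizing the linear isomorphism
`P = (p₁,p₂,p₃) : Λ²(A ⊗ k) ≅ (Λ²(A) ⊗ S²(k)) ⊕ (A ⊗ Λ²(k)) ⊕ (I_A ⊗ Λ²(k))`: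
`p₁(ax ∧ by) = a ∧ b ⊗ x ∨ y`, `p₂(ax ∧ by) = ab ⊗ x ∧ y`,
`p₃(ax ∧ by) = (a ∨ b - ab ∨ 1) ⊗ x ∧ y`. -/
def IsDecomposition (P : ↥(lambda2 K (A ⊗[K] k)) ≃ₗ[K] Wspace K A k) : Prop :=
  ∀ (a b : A) (x y : k),
    P ⟨wedge K (A ⊗[K] k) (a ⊗ₜ x) (b ⊗ₜ y), wedge_mem K _ _⟩ =
      ((⟨wedge K A a b, wedge_mem K a b⟩ ⊗ₜ[K] ⟨vee K k x y, vee_mem K x y⟩ : M1 K A k),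
       ((a * b) ⊗ₜ[K] ⟨wedge K k x y, wedge_mem K x y⟩ : M2 K A k),
       ((⟨vee K A a b - vee K A (a * b) 1, ia_el_mem K a b⟩ ⊗ₜ[K]
          ⟨wedge K k x y, wedge_mem K x y⟩ : M3 K A k)))

end Current

end CurrentPaper

namespace CurrentPaper

variable (K : Type*) [Field K] [CharZero K]
variable (A : Type*) [CommRing A] [Algebra K A]
variable (k : Type*) [LieRing k] [LieAlgebra K k]
variable (z : Type*) [AddCommGroup z] [Module K z]

/-- A `z`-valued linear map on `Λ²(g)` is a 2-cocycle iff it vanishes on `B₂(g)`. -/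
def IsCocycle (F : ↥(lambda2 K (A ⊗[K] k)) → z) : Prop :=
  ∀ t : ↥(lambda2 K (A ⊗[K] k)),
    (t : (A ⊗[K] k) ⊗[K] (A ⊗[K] k)) ∈ B2 K (A ⊗[K] k) → F t = 0

section Helpers

variable {K A k z}

lemma isCocycle_iff_forall_tmul (F : ↥(lambda2 K (A ⊗[K] k)) →ₗ[K] z) :
    IsCocycle K A k z F ↔ ∀ (a b c : A) (x y w : k),
      F ⟨dd K (A ⊗[K] k) (a ⊗ₜ x) (b ⊗ₜ y) (c ⊗ₜ w), dd_mem_lambda2 K _ _ _⟩ = 0 := by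
  refine ⟨fun h a b c x y w => h _ (dd_mem_B2 K _ _ _), fun h => ?_⟩
  set T := (LinearMap.ker F).map (lambda2 K (A ⊗[K] k)).subtype
  have hdd : ∀ u v w : A ⊗[K] k, dd K (A ⊗[K] k) u v w ∈ T := by
    intro u v w
    induction u using TensorProduct.induction_on with
    | zero => simp [dd, wedge]
    | add u u' hu hu' =>
      convert add_mem hu hu' using 1
      simp only [dd, wedge, add_lie, lie_add, TensorProduct.add_tmul, TensorProduct.tmul_add]
      module
    | tmul a x =>
      induction v using TensorProduct.induction_on with
      | zero => simp [dd, wedge]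
      | add v v' hv hv' =>
        convert add_mem hv hv' using 1
        simp only [dd, wedge, add_lie, lie_add, TensorProduct.add_tmul, TensorProduct.tmul_add]
        module
      | tmul b y =>
        induction w using TensorProduct.induction_on with
        | zero => simp [dd, wedge]
        | add w w' hw hw' =>
          convert add_mem hw hw' using 1
          simp only [dd, wedge, add_lie, lie_add, TensorProduct.add_tmul, TensorProduct.tmul_add]
          module
        | tmul c w => exact ⟨_, h a b c x y w, rfl⟩
  intro t ht
  have hle : B2 K (A ⊗[K] k) ≤ T := by
    refine Submodule.span_le.mpr ?_
    rintro _ ⟨u, v, w, rfl⟩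
    exact hdd u v w
  obtain ⟨s, hs, hst⟩ := hle ht
  rw [← Subtype.ext hst]
  exact hs

lemma apply_dd_tmul (P : ↥(lambda2 K (A ⊗[K] k)) ≃ₗ[K] Wspace K A k)
    (a b c : A) (x y w : k) :
    P ⟨dd K (A ⊗[K] k) (a ⊗ₜ x) (b ⊗ₜ y) (c ⊗ₜ w), dd_mem_lambda2 K _ _ _⟩ =
      P ⟨wedge K (A ⊗[K] k) ((a * b) ⊗ₜ ⁅x, y⁆) (c ⊗ₜ w), wedge_mem K _ _⟩ +
      P ⟨wedge K (A ⊗[K] k) ((b * c) ⊗ₜ ⁅y, w⁆) (a ⊗ₜ x), wedge_mem K _ _⟩ +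
      P ⟨wedge K (A ⊗[K] k) ((c * a) ⊗ₜ ⁅w, x⁆) (b ⊗ₜ y), wedge_mem K _ _⟩ := by
  rw [← map_add, ← map_add]
  congr 1

/-- The coboundaries of `a x ∧ b y ∧ w` and `b x ∧ a y ∧ w`, corrected by those of
`ab x ∧ y ∧ w` and `x ∧ ab y ∧ w`, have no components in the first two summands, so a cocycle
kills their third component. -/
lemma third_component_eq_zero {P : ↥(lambda2 K (A ⊗[K] k)) ≃ₗ[K] Wspace K A k}
    (hP : IsDecomposition K P)
    (f1 : M1 K A k →ₗ[K] z) (f2 : M2 K A k →ₗ[K] z) (f3 : M3 K A k →ₗ[K] z)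
    (h : ∀ (a b c : A) (x y w : k),
      (f1.coprod (f2.coprod f3)) (P ⟨dd K (A ⊗[K] k) (a ⊗ₜ x) (b ⊗ₜ y) (c ⊗ₜ w),
        dd_mem_lambda2 K _ _ _⟩) = 0)
    (a b : A) (x y w : k) :
    f3 (⟨vee K A a b - vee K A (a * b) 1, ia_el_mem K a b⟩ ⊗ₜ[K]
      ⟨wedge K k ⁅x, y⁆ w, wedge_mem K _ _⟩) = 0 := by
  have key : ∀ x y w : k,
      f3 (⟨vee K A a b - vee K A (a * b) 1, ia_el_mem K a b⟩ ⊗ₜ[K]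
        ⟨wedge K k ⁅y, w⁆ x, wedge_mem K _ _⟩) +
      f3 (⟨vee K A a b - vee K A (a * b) 1, ia_el_mem K a b⟩ ⊗ₜ[K]
        ⟨wedge K k ⁅w, x⁆ y, wedge_mem K _ _⟩) = 0 := by
    intro x y w
    have hskew : ∀ (a b : A) (s : ↥(sym2 K k)),
        f1 (⟨wedge K A b a, wedge_mem K b a⟩ ⊗ₜ[K] s) =
          -f1 (⟨wedge K A a b, wedge_mem K a b⟩ ⊗ₜ[K] s) := by
      intro a b s
      rw [← map_neg, ← TensorProduct.neg_tmul]
      congr 2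
      ext
      simp [wedge, ← smul_neg]
    have hsymm : (⟨vee K A b a - vee K A (b * a) 1, ia_el_mem K b a⟩ : ↥(ia K A)) =
        ⟨vee K A a b - vee K A (a * b) 1, ia_el_mem K a b⟩ := by
      simp [vee, mul_comm b a, add_comm (b ⊗ₜ[K] a)]
    have hright : ∀ a : A,
        (⟨vee K A a 1 - vee K A (a * 1) 1, ia_el_mem K a 1⟩ : ↥(ia K A)) = 0 := by
      intro a; ext; simp
    have hleft : ∀ a : A,
        (⟨vee K A 1 a - vee K A (1 * a) 1, ia_el_mem K 1 a⟩ : ↥(ia K A)) = 0 := by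
      intro a; ext; simp [vee, add_comm (a ⊗ₜ[K] (1 : A))]
    have e1 := h a b 1 x y w
    have e2 := h b a 1 x y w
    have e3 := h (a * b) 1 1 x y w
    have e4 := h 1 (a * b) 1 x y w
    simp only [apply_dd_tmul, hP _ _ _ _, map_add, LinearMap.coprod_apply] at e1 e2 e3 e4
    simp only [one_mul, mul_one, mul_comm b a] at e1 e2 e3 e4
    simp only [one_mul, mul_one, mul_comm b a] at hsymm hright hleft
    simp only [hsymm, hright, hleft, TensorProduct.zero_tmul, map_zero, hskew a b,
      hskew (a * b) 1] at e1 e2 e3 e4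
    linear_combination (norm := module) (2 : K)⁻¹ • (e1 + e2 - e3 - e4)
  linear_combination (norm := module) (2 : K)⁻¹ • (key y w x + key w x y - key x y w)

end Helpers

/-- `f = f₁∘p₁ + f₂∘p₂ + f₃∘p₃` is a 2-cocycle if and only if
`f₁∘p₁ + f₂∘p₂` and `f₃∘p₃` are 2-cocycles. -/
theorem statement8
    (P : ↥(lambda2 K (A ⊗[K] k)) ≃ₗ[K] Wspace K A k) (hP : IsDecomposition K P)
    (f1 : M1 K A k →ₗ[K] z) (f2 : M2 K A k →ₗ[K] z) (f3 : M3 K A k →ₗ[K] z) :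
    IsCocycle K A k z (fun t => f1 (P t).1 + f2 (P t).2.1 + f3 (P t).2.2) ↔
      (IsCocycle K A k z (fun t => f1 (P t).1 + f2 (P t).2.1) ∧
       IsCocycle K A k z (fun t => f3 (P t).2.2)) := by
  have split : ∀ t, f1 (P t).1 + f2 (P t).2.1 + f3 (P t).2.2 =
      (f1.coprod (f2.coprod f3)) (P t) := fun t => by
    simp only [LinearMap.coprod_apply, add_assoc]
  constructor
  · intro h
    have hf : ∀ (a b c : A) (x y w : k), (f1.coprod (f2.coprod f3))
        (P ⟨dd K (A ⊗[K] k) (a ⊗ₜ x) (b ⊗ₜ y) (c ⊗ₜ w), dd_mem_lambda2 K _ _ _⟩) = 0 :=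
      fun a b c x y w => (split _).symm.trans (h _ (dd_mem_B2 K _ _ _))
    have h3 : IsCocycle K A k z (fun t => f3 (P t).2.2) := by
      refine (isCocycle_iff_forall_tmul
        (f3 ∘ₗ LinearMap.snd K _ _ ∘ₗ LinearMap.snd K _ _ ∘ₗ P.toLinearMap)).mpr ?_
      intro a b c x y w
      have hz := third_component_eq_zero hP f1 f2 f3 hf
      simp only [LinearMap.comp_apply, LinearEquiv.coe_coe, apply_dd_tmul, hP _ _ _ _, map_add,
        LinearMap.snd_apply, hz, add_zero]
    exact ⟨fun t ht => by simpa [h3 t ht] using h t ht, h3⟩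
  · rintro ⟨h12, h3⟩ t ht
    simpa using congrArg₂ (· + ·) (h12 t ht) (h3 t ht)

end CurrentPaper
end

section
/- For linear maps of a single type the following hold: (i) f₁∘p₁ is a 2-cocycle on g if and only if im(f̃₁) ⊆ Sym²(k,z)^k and the induced alternating bilinear map A×A → Lin(k∨k', z), (a,b) ↦ f̃₁(a,b) restricted to k∨k', is a cyclic 1-cocycle, i.e. f₁(T(a,b,c) ⊗ x∨y) = 0 for all a,b,c ∈ A, x ∈ k, y ∈ k'; (ii) f₂∘p₂ is a 2-cocycle on g if and only if f̃₂(a) ∈ Z²(k,z) for all a ∈ A; (iii) f₃∘p₃ is a 2-cocycle on g if and only if f̃₃(c)(x,y) = 0 for all c ∈ I_A, x ∈ k, y ∈ k'. -/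
set_option linter.unusedSectionVars false
set_option synthInstance.maxHeartbeats 1000000
set_option maxHeartbeats 1000000
open scoped TensorProduct

namespace CurrentPaper

variable (K : Type*) [Field K] [CharZero K]
variable (A : Type*) [CommRing A] [Algebra K A]
variable (k : Type*) [LieRing k] [LieAlgebra K k]
variable (z : Type*) [AddCommGroup z] [Module K z]

section Helpers

variable {V : Type*} [AddCommGroup V] [Module K V]

/-- The exterior product `(x, y) ↦ x ∧ y` as a bilinear map into `Λ²(V)`. -/
noncomputable def wedgeHom : V →ₗ[K] V →ₗ[K] ↥(lambda2 K V) :=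
  LinearMap.mk₂ K (fun x y => ⟨wedge K V x y, wedge_mem K x y⟩)
    (fun x x' y => Subtype.ext <| by
      simp only [wedge, TensorProduct.add_tmul, TensorProduct.tmul_add, Submodule.coe_add]; module)
    (fun c x y => Subtype.ext <| by
      simp only [wedge, ← TensorProduct.smul_tmul', TensorProduct.tmul_smul, Submodule.coe_smul]
      module)
    (fun x y y' => Subtype.ext <| by
      simp only [wedge, TensorProduct.add_tmul, TensorProduct.tmul_add, Submodule.coe_add]; module)
    (fun c x y => Subtype.ext <| by
      simp only [wedge, ← TensorProduct.smul_tmul', TensorProduct.tmul_smul, Submodule.coe_smul]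
      module)

/-- The symmetric product `(x, y) ↦ x ∨ y` as a bilinear map into `S²(V)`. -/
noncomputable def veeHom : V →ₗ[K] V →ₗ[K] ↥(sym2 K V) :=
  LinearMap.mk₂ K (fun x y => ⟨vee K V x y, vee_mem K x y⟩)
    (fun x x' y => Subtype.ext <| by
      simp only [vee, TensorProduct.add_tmul, TensorProduct.tmul_add, Submodule.coe_add]; module)
    (fun c x y => Subtype.ext <| by
      simp only [vee, ← TensorProduct.smul_tmul', TensorProduct.tmul_smul, Submodule.coe_smul]
      module)
    (fun x y y' => Subtype.ext <| by
      simp only [vee, TensorProduct.add_tmul, TensorProduct.tmul_add, Submodule.coe_add]; module)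
    (fun c x y => Subtype.ext <| by
      simp only [vee, ← TensorProduct.smul_tmul', TensorProduct.tmul_smul, Submodule.coe_smul]
      module)

lemma wedgeHom_swap (x y : V) : wedgeHom K x y = -wedgeHom K y x :=
  Subtype.ext <| show wedge K V x y = -wedge K V y x by simp only [wedge]; module

lemma veeHom_swap (x y : V) : veeHom K x y = veeHom K y x :=
  Subtype.ext <| show vee K V x y = vee K V y x by simp only [vee]; module

lemma mk_dd (L : Type*) [LieRing L] [Module K L] (u v w : L) :
    (⟨dd K L u v w, dd_mem_lambda2 K u v w⟩ : ↥(lambda2 K L)) =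
      wedgeHom K ⁅u, v⁆ w + wedgeHom K ⁅v, w⁆ u + wedgeHom K ⁅w, u⁆ v := rfl

/-- The element `a ∨ b - ab ∨ 1` of `I_A`. -/
noncomputable def iaEl (a b : A) : ↥(ia K A) := ⟨vee K A a b - vee K A (a * b) 1, ia_el_mem K a b⟩

lemma iaEl_one (a : A) : iaEl K A a 1 = 0 := Subtype.ext <| by simp [iaEl]

lemma iaEl_swap (a b : A) : iaEl K A a b = iaEl K A b a :=
  Subtype.ext <| by simp only [iaEl, vee, mul_comm b a, add_comm (b ⊗ₜ[K] a)]

lemma mul'_vee (a b : A) : LinearMap.mul' K A (vee K A a b) = a * b := by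
  simp only [vee, map_smul, map_add, LinearMap.mul'_apply, mul_comm b a]
  module

/-- `I_A` is spanned by the elements `a ∨ b - ab ∨ 1`. -/
lemma span_iaEl : Submodule.span K {t | ∃ a b : A, t = iaEl K A a b} = ⊤ := by
  have key : ∀ s ∈ sym2 K A, s - vee K A (LinearMap.mul' K A s) 1 ∈
      (Submodule.span K {t | ∃ a b : A, t = iaEl K A a b}).map (ia K A).subtype := by
    intro s hs
    have hle : sym2 K A ≤ ((Submodule.span K {t | ∃ a b : A, t = iaEl K A a b}).map
        (ia K A).subtype).comap (LinearMap.id - (sym2 K A).subtype ∘ₗ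
          ((veeHom K).flip 1) ∘ₗ LinearMap.mul' K A) := by
      refine Submodule.span_le.mpr ?_
      rintro _ ⟨a, b, rfl⟩
      refine ⟨iaEl K A a b, Submodule.subset_span ⟨a, b, rfl⟩, ?_⟩
      change vee K A a b - vee K A (a * b) 1 =
        vee K A a b - vee K A (LinearMap.mul' K A (vee K A a b)) 1
      rw [mul'_vee]
    exact hle hs
  refine eq_top_iff.mpr ?_
  rintro ⟨s, hs⟩ -
  obtain ⟨hs₁, hs₂⟩ := Submodule.mem_inf.mp hs
  have h := key s hs₁
  rw [LinearMap.mem_ker.mp hs₂] at h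
  have h0 : vee K A (0 : A) 1 = 0 := by simp [vee]
  rw [h0, sub_zero] at h
  obtain ⟨t, ht, hts⟩ := h
  obtain rfl : t = ⟨s, hs⟩ := Subtype.ext hts
  exact ht

/-- The cocycle condition only has to be tested on elementary tensors. -/
lemma isCocycle_iff (G : ↥(lambda2 K (A ⊗[K] k)) →ₗ[K] z) :
    IsCocycle K A k z G ↔ ∀ (a b c : A) (x y w : k),
      G (wedgeHom K ((a * b) ⊗ₜ[K] ⁅x, y⁆) (c ⊗ₜ[K] w)) +
        G (wedgeHom K ((b * c) ⊗ₜ[K] ⁅y, w⁆) (a ⊗ₜ[K] x)) +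
        G (wedgeHom K ((c * a) ⊗ₜ[K] ⁅w, x⁆) (b ⊗ₜ[K] y)) = 0 := by
  constructor
  · intro h a b c x y w
    have := h ⟨_, dd_mem_lambda2 K (a ⊗ₜ[K] x) (b ⊗ₜ[K] y) (c ⊗ₜ[K] w)⟩ (dd_mem_B2 K _ _ _)
    rw [mk_dd] at this
    simpa only [map_add, LieAlgebra.ExtendScalars.bracket_tmul] using this
  · intro h
    have hdd : ∀ u v w : A ⊗[K] k, G (wedgeHom K ⁅u, v⁆ w) + G (wedgeHom K ⁅v, w⁆ u) +
        G (wedgeHom K ⁅w, u⁆ v) = 0 := by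
      intro u v w
      induction u with
      | zero => simp
      | add u u' hu hu' =>
        simp only [add_lie, lie_add, map_add, LinearMap.add_apply]
        linear_combination (norm := module) hu + hu'
      | tmul a x =>
        induction v with
        | zero => simp
        | add v v' hv hv' =>
          simp only [add_lie, lie_add, map_add, LinearMap.add_apply]
          linear_combination (norm := module) hv + hv'
        | tmul b y =>
          induction w with
          | zero => simp
          | add w w' hw hw' =>
            simp only [add_lie, lie_add, map_add, LinearMap.add_apply]
            linear_combination (norm := module) hw + hw'
          | tmul c w => simpa only [LieAlgebra.ExtendScalars.bracket_tmul] using h a b c x y w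
    have hle : B2 K (A ⊗[K] k) ≤
        (LinearMap.ker G).map (lambda2 K (A ⊗[K] k)).subtype := by
      refine Submodule.span_le.mpr ?_
      rintro _ ⟨u, v, w, rfl⟩
      refine ⟨⟨_, dd_mem_lambda2 K u v w⟩, ?_, rfl⟩
      rw [SetLike.mem_coe, LinearMap.mem_ker, mk_dd, map_add, map_add]
      exact hdd u v w
    rintro t ht
    obtain ⟨s, hs, hst⟩ := hle ht
    obtain rfl : s = t := Subtype.ext hst
    exact hs

variable {K A k z}

/-- A linear map on `k` vanishes on `[k,k]` as soon as it vanishes on brackets. -/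
lemma eq_zero_of_mem_derived (φ : k →ₗ[K] z) (h : ∀ u v : k, φ ⁅u, v⁆ = 0) {y : k}
    (hy : y ∈ derived K k) : φ y = 0 := by
  have hle : derived K k ≤ LinearMap.ker φ := by
    refine Submodule.span_le.mpr ?_
    rintro _ ⟨u, v, rfl⟩
    exact h u v
  exact hle hy

lemma lie_mem_derived (u v : k) : ⁅u, v⁆ ∈ derived K k := Submodule.subset_span ⟨u, v, rfl⟩

section Neg

variable {M N : Type*} [AddCommGroup M] [Module K M] [AddCommGroup N] [Module K N]

lemma map_neg_tmul (f : M ⊗[K] N →ₗ[K] z) (m : M) (n : N) :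
    f ((-m) ⊗ₜ[K] n) = -f (m ⊗ₜ[K] n) :=
  (f ∘ₗ (TensorProduct.mk K M N).flip n).map_neg m

lemma map_tmul_neg (f : M ⊗[K] N →ₗ[K] z) (m : M) (n : N) :
    f (m ⊗ₜ[K] (-n)) = -f (m ⊗ₜ[K] n) :=
  (f ∘ₗ TensorProduct.mk K M N m).map_neg n

end Neg

lemma isCocycle_type_one_iff (f : M1 K A k →ₗ[K] z) :
    (∀ (a b c : A) (x y w : k),
      f (wedgeHom K (a * b) c ⊗ₜ[K] veeHom K ⁅x, y⁆ w) +
        f (wedgeHom K (b * c) a ⊗ₜ[K] veeHom K ⁅y, w⁆ x) +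
        f (wedgeHom K (c * a) b ⊗ₜ[K] veeHom K ⁅w, x⁆ y) = 0) ↔
    (∀ (a b : A) (x y w : k), f (wedgeHom K a b ⊗ₜ[K] veeHom K ⁅x, y⁆ w) =
        f (wedgeHom K a b ⊗ₜ[K] veeHom K x ⁅y, w⁆)) ∧
      ∀ (a b c : A) (x y : k), y ∈ derived K k →
        f ((wedgeHom K (a * b) c + wedgeHom K (b * c) a + wedgeHom K (c * a) b) ⊗ₜ[K]
          veeHom K x y) = 0 := by
  constructor
  · intro h
    have hone : ∀ (a : A) (x y w : k), f (wedgeHom K a 1 ⊗ₜ[K] veeHom K ⁅x, y⁆ w) = 0 := by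
      intro a x y w
      have h₁ := h a 1 1 x y w
      have h₂ := h a 1 1 y w x
      simp only [mul_one, one_mul, wedgeHom_swap K 1 a, map_neg_tmul] at h₁ h₂
      have h₃ : (2 : K) • f (wedgeHom K a 1 ⊗ₜ[K] veeHom K ⁅x, y⁆ w) = 0 := by
        linear_combination (norm := module) h₁ + h₂
      exact (smul_eq_zero.mp h₃).resolve_left two_ne_zero
    have hinv : ∀ (a b : A) (x y w : k), f (wedgeHom K a b ⊗ₜ[K] veeHom K ⁅x, y⁆ w) =
        f (wedgeHom K a b ⊗ₜ[K] veeHom K ⁅y, w⁆ x) := by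
      intro a b x y w
      have h₁ := h a b 1 w x y
      simp only [hone, mul_one, one_mul, wedgeHom_swap K b a, map_neg_tmul,
        zero_add] at h₁
      exact (neg_add_eq_zero.mp h₁)
    refine ⟨fun a b x y w => (hinv a b x y w).trans (by rw [veeHom_swap]), ?_⟩
    intro a b c x y hy
    refine eq_zero_of_mem_derived (f ∘ₗ TensorProduct.mk K _ _ _ ∘ₗ veeHom K x) (fun u v => ?_) hy
    change f (_ ⊗ₜ[K] veeHom K x ⁅u, v⁆) = 0
    rw [veeHom_swap, TensorProduct.add_tmul, TensorProduct.add_tmul, map_add, map_add,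
      ← h a b c u v x, hinv (b * c) a u v x, hinv (c * a) b u v x, hinv (c * a) b v x u]
  · rintro ⟨hinv, hT⟩ a b c x y w
    have hcyc : ∀ (a b : A) (x y w : k), f (wedgeHom K a b ⊗ₜ[K] veeHom K ⁅x, y⁆ w) =
        f (wedgeHom K a b ⊗ₜ[K] veeHom K ⁅y, w⁆ x) := fun a b x y w => by
      rw [hinv, veeHom_swap]
    have h₁ := hT a b c w ⁅x, y⁆ (lie_mem_derived x y)
    rw [veeHom_swap, TensorProduct.add_tmul, TensorProduct.add_tmul, map_add, map_add,
      hcyc (b * c) a x y w, hcyc (c * a) b x y w, hcyc (c * a) b y w x] at h₁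
    exact h₁

lemma isCocycle_type_two_iff (f : M2 K A k →ₗ[K] z) :
    (∀ (a b c : A) (x y w : k),
      f ((a * b * c) ⊗ₜ[K] wedgeHom K ⁅x, y⁆ w) + f ((b * c * a) ⊗ₜ[K] wedgeHom K ⁅y, w⁆ x) +
        f ((c * a * b) ⊗ₜ[K] wedgeHom K ⁅w, x⁆ y) = 0) ↔
    ∀ (a : A) (x y w : k), f (a ⊗ₜ[K]
      (wedgeHom K ⁅x, y⁆ w + wedgeHom K ⁅y, w⁆ x + wedgeHom K ⁅w, x⁆ y)) = 0 := by
  simp only [TensorProduct.tmul_add, map_add]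
  constructor
  · intro h a x y w
    simpa only [mul_one, one_mul] using h a 1 1 x y w
  · intro h a b c x y w
    rw [show b * c * a = a * b * c by ring, show c * a * b = a * b * c by ring]
    exact h (a * b * c) x y w

lemma isCocycle_type_three_iff (f : M3 K A k →ₗ[K] z) :
    (∀ (a b c : A) (x y w : k),
      f (iaEl K A (a * b) c ⊗ₜ[K] wedgeHom K ⁅x, y⁆ w) +
        f (iaEl K A (b * c) a ⊗ₜ[K] wedgeHom K ⁅y, w⁆ x) +
        f (iaEl K A (c * a) b ⊗ₜ[K] wedgeHom K ⁅w, x⁆ y) = 0) ↔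
    ∀ (c : ↥(ia K A)) (x y : k), y ∈ derived K k → f (c ⊗ₜ[K] wedgeHom K x y) = 0 := by
  constructor
  · intro h
    have hskew : ∀ (a b : A) (x y w : k), f (iaEl K A a b ⊗ₜ[K] wedgeHom K ⁅x, y⁆ w) =
        -f (iaEl K A a b ⊗ₜ[K] wedgeHom K ⁅y, w⁆ x) := by
      intro a b x y w
      have h₁ := h a b 1 w x y
      simp only [iaEl_one, mul_one, one_mul, iaEl_swap K A b a, TensorProduct.zero_tmul, map_zero,
        zero_add] at h₁
      exact eq_neg_of_add_eq_zero_left h₁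
    have hzero : ∀ (a b : A) (x y w : k), f (iaEl K A a b ⊗ₜ[K] wedgeHom K ⁅x, y⁆ w) = 0 := by
      intro a b x y w
      have h₁ := hskew a b x y w
      rw [hskew a b y w x, hskew a b w x y, neg_neg] at h₁
      have h₂ : (2 : K) • f (iaEl K A a b ⊗ₜ[K] wedgeHom K ⁅x, y⁆ w) = 0 := by
        rw [two_smul]
        exact eq_neg_iff_add_eq_zero.mp h₁
      exact (smul_eq_zero.mp h₂).resolve_left two_ne_zero
    intro c x y hy
    have hle : Submodule.span K {t | ∃ a b : A, t = iaEl K A a b} ≤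
        LinearMap.ker (f ∘ₗ (TensorProduct.mk K _ _).flip (wedgeHom K x y)) := by
      refine Submodule.span_le.mpr ?_
      rintro _ ⟨a, b, rfl⟩
      refine eq_zero_of_mem_derived
        (f ∘ₗ TensorProduct.mk K _ _ (iaEl K A a b) ∘ₗ wedgeHom K x) (fun u v => ?_) hy
      change f (_ ⊗ₜ[K] wedgeHom K x ⁅u, v⁆) = 0
      rw [wedgeHom_swap, map_tmul_neg, hzero, neg_zero]
    rw [span_iaEl] at hle
    exact hle (Submodule.mem_top (x := c))
  · intro h a b c x y w
    have hzero : ∀ (c : ↥(ia K A)) (x y w : k), f (c ⊗ₜ[K] wedgeHom K ⁅x, y⁆ w) = 0 := by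
      intro c x y w
      rw [wedgeHom_swap, map_tmul_neg, h c w _ (lie_mem_derived x y), neg_zero]
    simp only [hzero, add_zero]

end Helpers

/-- Characterization of 2-cocycles of the three pure types
`f₁∘p₁`, `f₂∘p₂` and `f₃∘p₃`. -/
theorem statement9
    (P : ↥(lambda2 K (A ⊗[K] k)) ≃ₗ[K] Wspace K A k) (hP : IsDecomposition K P)
    (f1 : M1 K A k →ₗ[K] z) (f2 : M2 K A k →ₗ[K] z) (f3 : M3 K A k →ₗ[K] z) :
    (IsCocycle K A k z (fun t => f1 (P t).1) ↔
      ((∀ (a b : A) (x y w : k),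
          f1 (⟨wedge K A a b, wedge_mem K a b⟩ ⊗ₜ[K] ⟨vee K k ⁅x, y⁆ w, vee_mem K _ _⟩) =
            f1 (⟨wedge K A a b, wedge_mem K a b⟩ ⊗ₜ[K] ⟨vee K k x ⁅y, w⁆, vee_mem K _ _⟩)) ∧
       (∀ (a b c : A) (x y : k), y ∈ derived K k →
          f1 (⟨wedge K A (a*b) c + wedge K A (b*c) a + wedge K A (c*a) b,
              TA_el_mem_lambda2 K a b c⟩ ⊗ₜ[K] ⟨vee K k x y, vee_mem K x y⟩) = 0))) ∧
    (IsCocycle K A k z (fun t => f2 (P t).2.1) ↔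
      (∀ (a : A) (x y w : k), f2 (a ⊗ₜ[K] ⟨dd K k x y w, dd_mem_lambda2 K x y w⟩) = 0)) ∧
    (IsCocycle K A k z (fun t => f3 (P t).2.2) ↔
      (∀ (c : ↥(ia K A)) (x y : k), y ∈ derived K k →
        f3 (c ⊗ₜ[K] ⟨wedge K k x y, wedge_mem K x y⟩) = 0)) := by
  have hP' : ∀ (a b : A) (x y : k), P (wedgeHom K (a ⊗ₜ[K] x) (b ⊗ₜ[K] y)) =
      (wedgeHom K a b ⊗ₜ[K] veeHom K x y, (a * b) ⊗ₜ[K] wedgeHom K x y,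
        iaEl K A a b ⊗ₜ[K] wedgeHom K x y) := hP
  refine ⟨?_, ?_, ?_⟩
  · refine (isCocycle_iff K A k z (f1 ∘ₗ LinearMap.fst K _ _ ∘ₗ P.toLinearMap)).trans
      (Iff.trans ?_ (isCocycle_type_one_iff f1))
    simp [hP']
  · refine (isCocycle_iff K A k z
      (f2 ∘ₗ LinearMap.fst K _ _ ∘ₗ LinearMap.snd K _ _ ∘ₗ P.toLinearMap)).trans
      (Iff.trans ?_ (isCocycle_type_two_iff f2))
    simp [hP']
  · refine (isCocycle_iff K A k z
      (f3 ∘ₗ LinearMap.snd K _ _ ∘ₗ LinearMap.snd K _ _ ∘ₗ P.toLinearMap)).trans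
      (Iff.trans ?_ (isCocycle_type_three_iff f3))
    simp [hP']

end CurrentPaper
end

section
/- There exist a K-vector space z and a coupled 2-cocycle on g = A⊗k with values in z if and only if d_A(A) ≠ {0} and k possesses an invariant symmetric bilinear form κ ∈ Sym²(k)^k (with values in K) for which the 3-cocycle Γ(κ) is a non-zero 3-coboundary. -/
set_option linter.unusedSectionVars false
set_option synthInstance.maxHeartbeats 1000000
set_option maxHeartbeats 1000000
open scoped TensorProduct

namespace CurrentPaper

universe u v w

variable (K : Type u) [Field K] [CharZero K]
variable (A : Type v) [CommRing A] [Algebra K A]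
variable (k : Type w) [LieRing k] [LieAlgebra K k]

/-- A coupled 2-cocycle on `g = A ⊗ k` with values in some `K`-vector space `z`:
a 2-cocycle of the form `f₁∘p₁ + f₂∘p₂` for which `f₁∘p₁` is not itself a 2-cocycle. -/
structure CoupledCocycle (P : ↥(lambda2 K (A ⊗[K] k)) ≃ₗ[K] Wspace K A k) where
  /-- the space of values -/
  z : Type (max u v w)
  [agz : AddCommGroup z]
  [mz : Module K z]
  /-- the component `f₁ : Λ²(A) ⊗ S²(k) → z` -/
  f1 : M1 K A k →ₗ[K] z
  /-- the component `f₂ : A ⊗ Λ²(k) → z` -/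
  f2 : M2 K A k →ₗ[K] z
  /-- `f₁∘p₁ + f₂∘p₂` vanishes on `B₂(g)`, i.e. it is a 2-cocycle -/
  cocycle : ∀ t : ↥(lambda2 K (A ⊗[K] k)),
    (t : (A ⊗[K] k) ⊗[K] (A ⊗[K] k)) ∈ B2 K (A ⊗[K] k) → f1 (P t).1 + f2 (P t).2.1 = 0
  /-- but `f₁∘p₁` is not a 2-cocycle -/
  coupled : ¬ ∀ t : ↥(lambda2 K (A ⊗[K] k)),
    (t : (A ⊗[K] k) ⊗[K] (A ⊗[K] k)) ∈ B2 K (A ⊗[K] k) → f1 (P t).1 = 0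

section Bilinear

variable {V : Type*} [AddCommGroup V] [Module K V]

/-- The wedge product as an alternating bilinear map into `Λ²(V)`. -/
noncomputable def wedgeBilin : V →ₗ[K] V →ₗ[K] lambda2 K V :=
  LinearMap.mk₂ K (fun x y => ⟨wedge K V x y, wedge_mem K x y⟩)
    (fun x x' y => Subtype.ext <| by
      simp only [wedge, Submodule.coe_add, TensorProduct.add_tmul, TensorProduct.tmul_add]; module)
    (fun c x y => Subtype.ext <| by
      simp only [wedge, Submodule.coe_smul, ← TensorProduct.smul_tmul', TensorProduct.tmul_smul]
      module)
    (fun x y y' => Subtype.ext <| by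
      simp only [wedge, Submodule.coe_add, TensorProduct.add_tmul, TensorProduct.tmul_add]; module)
    (fun c x y => Subtype.ext <| by
      simp only [wedge, Submodule.coe_smul, ← TensorProduct.smul_tmul', TensorProduct.tmul_smul]
      module)

/-- The symmetric product as a symmetric bilinear map into `S²(V)`. -/
noncomputable def veeBilin : V →ₗ[K] V →ₗ[K] sym2 K V :=
  LinearMap.mk₂ K (fun x y => ⟨vee K V x y, vee_mem K x y⟩)
    (fun x x' y => Subtype.ext <| by
      simp only [vee, Submodule.coe_add, TensorProduct.add_tmul, TensorProduct.tmul_add]; module)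
    (fun c x y => Subtype.ext <| by
      simp only [vee, Submodule.coe_smul, ← TensorProduct.smul_tmul', TensorProduct.tmul_smul]
      module)
    (fun x y y' => Subtype.ext <| by
      simp only [vee, Submodule.coe_add, TensorProduct.add_tmul, TensorProduct.tmul_add]; module)
    (fun c x y => Subtype.ext <| by
      simp only [vee, Submodule.coe_smul, ← TensorProduct.smul_tmul', TensorProduct.tmul_smul]
      module)

lemma wedgeBilin_self (x : V) : wedgeBilin K x x = 0 :=
  Subtype.ext <| by simp [wedgeBilin, wedge]

lemma wedgeBilin_swap (x y : V) : wedgeBilin K x y = -wedgeBilin K y x :=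
  Subtype.ext <| by simp [wedgeBilin, wedge, ← smul_neg]

lemma veeBilin_swap (x y : V) : veeBilin K x y = veeBilin K y x :=
  Subtype.ext <| by simp [veeBilin, vee, add_comm]

end Bilinear

section Boundary

variable {A k}

/-- Linear maps vanish on `B₂(A ⊗ k)` as soon as they vanish on boundaries of pure tensors. -/
lemma eq_zero_on_B2_iff {z : Type*} [AddCommGroup z] [Module K z]
    (f : lambda2 K (A ⊗[K] k) →ₗ[K] z) :
    (∀ t : lambda2 K (A ⊗[K] k), (t : (A ⊗[K] k) ⊗[K] (A ⊗[K] k)) ∈ B2 K (A ⊗[K] k) → f t = 0) ↔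
      ∀ (a b c : A) (x y w : k),
        f (wedgeBilin K ((a * b) ⊗ₜ ⁅x, y⁆) (c ⊗ₜ w)) +
          f (wedgeBilin K ((b * c) ⊗ₜ ⁅y, w⁆) (a ⊗ₜ x)) +
          f (wedgeBilin K ((c * a) ⊗ₜ ⁅w, x⁆) (b ⊗ₜ y)) = 0 := by
  let δ (u v w : A ⊗[K] k) : lambda2 K (A ⊗[K] k) :=
    wedgeBilin K ⁅u, v⁆ w + wedgeBilin K ⁅v, w⁆ u + wedgeBilin K ⁅w, u⁆ v
  have coe_δ (u v w) : (δ u v w : (A ⊗[K] k) ⊗[K] (A ⊗[K] k)) = dd K _ u v w := rfl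
  have δ_tmul (a b c : A) (x y w : k) : f (δ (a ⊗ₜ x) (b ⊗ₜ y) (c ⊗ₜ w)) =
        f (wedgeBilin K ((a * b) ⊗ₜ ⁅x, y⁆) (c ⊗ₜ w)) +
          f (wedgeBilin K ((b * c) ⊗ₜ ⁅y, w⁆) (a ⊗ₜ x)) +
          f (wedgeBilin K ((c * a) ⊗ₜ ⁅w, x⁆) (b ⊗ₜ y)) := by
    simp only [δ, LieAlgebra.ExtendScalars.bracket_tmul, map_add]
  constructor
  · intro h a b c x y w
    rw [← δ_tmul]
    exact h _ (coe_δ _ _ _ ▸ dd_mem_B2 K _ _ _)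
  · intro h
    have δ_cycle (u v w) : δ u v w = δ v w u := by simp only [δ]; abel
    have δ_add (u u' v w) : δ (u + u') v w = δ u v w + δ u' v w := by
      simp only [δ, add_lie, lie_add, map_add, LinearMap.add_apply]; abel
    have δ_zero (v w) : δ 0 v w = 0 := by simp [δ]
    have key (u v w) : f (δ u v w) = 0 := by
      induction u using TensorProduct.induction_on with
      | zero => rw [δ_zero, map_zero]
      | add u u' hu hu' => rw [δ_add, map_add, hu, hu', add_zero]
      | tmul a x =>
        rw [δ_cycle]
        induction v using TensorProduct.induction_on with
        | zero => rw [δ_zero, map_zero]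
        | add v v' hv hv' => rw [δ_add, map_add, hv, hv', add_zero]
        | tmul b y =>
          rw [δ_cycle]
          induction w using TensorProduct.induction_on with
          | zero => rw [δ_zero, map_zero]
          | add w w' hw hw' => rw [δ_add, map_add, hw, hw', add_zero]
          | tmul c w => rw [δ_cycle, δ_tmul, h]
    have hle : B2 K (A ⊗[K] k) ≤ (LinearMap.ker f).map (lambda2 K (A ⊗[K] k)).subtype := by
      refine Submodule.span_le.mpr ?_
      rintro _ ⟨u, v, w, rfl⟩
      exact ⟨δ u v w, key u v w, rfl⟩
    intro t ht
    obtain ⟨s, hs, hst⟩ := hle ht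
    rwa [← Subtype.ext hst]

variable (P : ↥(lambda2 K (A ⊗[K] k)) ≃ₗ[K] Wspace K A k)

variable {K P} in
lemma IsDecomposition.fst_apply (hP : IsDecomposition K P) (a b : A) (x y : k) :
    (P (wedgeBilin K (a ⊗ₜ x) (b ⊗ₜ y))).1 = wedgeBilin K a b ⊗ₜ veeBilin K x y :=
  congrArg Prod.fst (hP a b x y)

variable {K P} in
lemma IsDecomposition.snd_apply (hP : IsDecomposition K P) (a b : A) (x y : k) :
    (P (wedgeBilin K (a ⊗ₜ x) (b ⊗ₜ y))).2.1 = (a * b) ⊗ₜ wedgeBilin K x y :=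
  congrArg (fun t => t.2.1) (hP a b x y)

variable {K P} in
/-- The cocycle condition for `f₁∘p₁ + f₂∘p₂` in terms of pure tensors. -/
lemma IsDecomposition.cocycle_iff (hP : IsDecomposition K P) {z : Type*} [AddCommGroup z]
    [Module K z] (f₁ : M1 K A k →ₗ[K] z) (f₂ : M2 K A k →ₗ[K] z) :
    (∀ t : lambda2 K (A ⊗[K] k), (t : (A ⊗[K] k) ⊗[K] (A ⊗[K] k)) ∈ B2 K (A ⊗[K] k) →
      f₁ (P t).1 + f₂ (P t).2.1 = 0) ↔
      ∀ (a b c : A) (x y w : k),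
        f₁ (wedgeBilin K (a * b) c ⊗ₜ veeBilin K ⁅x, y⁆ w) +
          f₁ (wedgeBilin K (b * c) a ⊗ₜ veeBilin K ⁅y, w⁆ x) +
          f₁ (wedgeBilin K (c * a) b ⊗ₜ veeBilin K ⁅w, x⁆ y) +
          f₂ ((a * b * c) ⊗ₜ
            (wedgeBilin K ⁅x, y⁆ w + wedgeBilin K ⁅y, w⁆ x + wedgeBilin K ⁅w, x⁆ y)) = 0 := by
  let f : lambda2 K (A ⊗[K] k) →ₗ[K] z :=
    (f₁ ∘ₗ LinearMap.fst K _ _ + f₂ ∘ₗ LinearMap.fst K _ _ ∘ₗ LinearMap.snd K _ _) ∘ₗ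
      P.toLinearMap
  refine (eq_zero_on_B2_iff K f).trans ?_
  have hf (a b : A) (x y : k) : f (wedgeBilin K (a ⊗ₜ x) (b ⊗ₜ y)) =
      f₁ (wedgeBilin K a b ⊗ₜ veeBilin K x y) + f₂ ((a * b) ⊗ₜ wedgeBilin K x y) := by
    rw [← hP.fst_apply, ← hP.snd_apply]; rfl
  refine forall₃_congr fun a b c => forall₃_congr fun x y w => ?_
  rw [hf, hf, hf, show b * c * a = a * b * c by ring, show c * a * b = a * b * c by ring,
    TensorProduct.tmul_add, TensorProduct.tmul_add, map_add, map_add]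
  refine Eq.congr_left ?_
  abel

end Boundary

section Derivation

variable {A}

/-- A bilinear form `h` on `A` with `h(ab,c) + h(bc,a) + h(ca,b) = h(abc,1)` yields the derivation
`b ↦ (a ↦ h(a,b) + h(1,ab))` into the dual of `A`, which factors through the Kähler
differentials. -/
lemma exists_D_ne_zero_of_cyclic (h : A →ₗ[K] A →ₗ[K] K) (h_alt : ∀ a b, h a b = -h b a)
    (h_cyc : ∀ a b c, h (a * b) c + h (b * c) a + h (c * a) b = h (a * b * c) 1)
    {e : A} (he : h e 1 ≠ 0) : ∃ a : A, KaehlerDifferential.D K A a ≠ 0 := by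
  let _ : Module A (A →ₗ[K] K) :=
    { smul := fun a φ => φ ∘ₗ LinearMap.mulLeft K a
      one_smul := fun φ => LinearMap.ext fun x => congrArg φ (one_mul x)
      mul_smul := fun a b φ => LinearMap.ext fun x => congrArg φ
        (show a * b * x = b * (a * x) by ring)
      smul_zero := fun a => rfl
      smul_add := fun a φ ψ => rfl
      add_smul := fun a b φ => LinearMap.ext fun x =>
        (congrArg φ (add_mul a b x)).trans (map_add φ _ _)
      zero_smul := fun φ => LinearMap.ext fun x =>
        (congrArg φ (zero_mul x)).trans (map_zero φ) }
  have smul_apply (a : A) (φ : A →ₗ[K] K) (x : A) : (a • φ) x = φ (a * x) := rfl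
  have : IsScalarTower K A (A →ₗ[K] K) := ⟨fun c a φ => LinearMap.ext fun x => by
    rw [smul_apply, LinearMap.smul_apply, smul_apply, smul_mul_assoc, map_smul]⟩
  let D : Derivation K A (A →ₗ[K] K) := Derivation.mk'
    (h.flip + (LinearMap.mul K A).compr₂ (h 1)) fun a b => LinearMap.ext fun x => by
      simp only [LinearMap.add_apply, LinearMap.flip_apply, LinearMap.compr₂_apply,
        LinearMap.mul_apply', smul_apply]
      have h1 := h_cyc x a b
      rw [h_alt (a * b) x, h_alt (x * a * b) 1] at h1
      rw [show a * b * x = x * a * b by ring, show b * (a * x) = x * a * b by ring,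
        show a * (b * x) = x * a * b by ring, mul_comm a x]
      linear_combination -h1
  refine ⟨e, fun hz => he ?_⟩
  have hD : D e = 0 := by rw [← D.liftKaehlerDifferential_comp_D e, hz, map_zero]
  have h2 : h 1 e + h 1 (e * 1) = 0 := congrArg (fun φ : A →ₗ[K] K => φ 1) hD
  rw [mul_one, h_alt 1 e] at h2
  linear_combination (-1 / 2 : K) * h2

end Derivation

section Directions

variable {K A k} {P : ↥(lambda2 K (A ⊗[K] k)) ≃ₗ[K] Wspace K A k}

lemma CoupledCocycle.exists_D_ne_zero_and_form (hP : IsDecomposition K P)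
    (C : CoupledCocycle K A k P) :
    (∃ a : A, KaehlerDifferential.D K A a ≠ 0) ∧
       ∃ κ : k →ₗ[K] k →ₗ[K] K,
         (∀ x y : k, κ x y = κ y x) ∧
         (∀ x y w : k, κ ⁅x, y⁆ w = κ x ⁅y, w⁆) ∧
         (∃ η : k →ₗ[K] k →ₗ[K] K, (∀ x : k, η x x = 0) ∧
           ∀ x y w : k, κ ⁅x, y⁆ w = -(η ⁅x, y⁆ w) - η ⁅y, w⁆ x - η ⁅w, x⁆ y) ∧
         ∃ x y w : k, κ ⁅x, y⁆ w ≠ 0 := by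
  obtain ⟨z, f₁, f₂, hcoc, hcoup⟩ := C
  rw [hP.cocycle_iff] at hcoc
  let F (a b : A) (x y : k) : z := f₁ (wedgeBilin K a b ⊗ₜ veeBilin K x y)
  let G (a : A) (x y w : k) : z := f₂ (a ⊗ₜ
    (wedgeBilin K ⁅x, y⁆ w + wedgeBilin K ⁅y, w⁆ x + wedgeBilin K ⁅w, x⁆ y))
  have F_alt (a b x y) : F a b x y = -F b a x y := by
    simp only [F]; rw [wedgeBilin_swap]
    exact (congrArg f₁ (TensorProduct.neg_tmul _ _)).trans (map_neg f₁ _)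
  have F_symm (a b x y) : F a b x y = F a b y x := by
    simp only [F]; rw [veeBilin_swap]
  have hFG (a b c x y w) : F (a * b) c ⁅x, y⁆ w + F (b * c) a ⁅y, w⁆ x + F (c * a) b ⁅w, x⁆ y +
      G (a * b * c) x y w = 0 := hcoc a b c x y w
  have F_cycle (a b x y w) : F a b ⁅x, y⁆ w = F a b ⁅y, w⁆ x := by
    have h1 := hFG a b 1 w x y
    have h2 := hFG b a 1 w x y
    simp only [mul_one, one_mul] at h1 h2
    rw [mul_comm b a, F_alt b a ⁅y, w⁆ x] at h2
    rw [F_alt b a ⁅x, y⁆ w] at h1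
    have h3 : (2 : K) • (F a b ⁅x, y⁆ w - F a b ⁅y, w⁆ x) = 0 := by
      linear_combination (norm := module) h2 - h1
    exact sub_eq_zero.mp ((smul_eq_zero.mp h3).resolve_left two_ne_zero)
  have FG_one (a x y w) : F a 1 ⁅x, y⁆ w + G a x y w = 0 := by
    have h1 := hFG a 1 1 x y w
    simp only [mul_one, one_mul] at h1
    rw [F_alt 1 a, ← F_cycle a 1 x y w, F_cycle a 1 w x y] at h1
    rw [← h1]; abel
  have F_cyc (a b c : A) (x y w : k) :
      F (a * b) c ⁅x, y⁆ w + F (b * c) a ⁅x, y⁆ w + F (c * a) b ⁅x, y⁆ w =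
      F (a * b * c) 1 ⁅x, y⁆ w := by
    have h1 := hFG a b c x y w
    rw [← F_cycle (b * c) a, F_cycle (c * a) b w x y] at h1
    linear_combination (norm := module) h1 - FG_one (a * b * c) x y w
  obtain ⟨e, x₀, y₀, w₀, he⟩ : ∃ e x y w, F e 1 ⁅x, y⁆ w ≠ 0 := by
    by_contra! hzero
    refine hcoup ?_
    have h0 := hP.cocycle_iff f₁ 0
    simp only [LinearMap.zero_apply, add_zero] at h0
    refine h0.mpr fun a b c x y w => ?_
    change F (a * b) c ⁅x, y⁆ w + F (b * c) a ⁅y, w⁆ x + F (c * a) b ⁅w, x⁆ y = 0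
    rw [← F_cycle (b * c) a, F_cycle (c * a) b w x y, F_cyc, hzero]
  obtain ⟨φ, hφ⟩ : ∃ φ : Module.Dual K z, φ (F e 1 ⁅x₀, y₀⁆ w₀) ≠ 0 := by
    by_contra! hzero
    exact he ((Module.forall_dual_apply_eq_zero_iff K _).mp hzero)
  refine ⟨exists_D_ne_zero_of_cyclic K ((wedgeBilin K).compr₂
      (φ ∘ₗ f₁ ∘ₗ (TensorProduct.mk K _ _).flip (veeBilin K ⁅x₀, y₀⁆ w₀)))
      (fun a b => (congrArg φ (F_alt a b ⁅x₀, y₀⁆ w₀)).trans (map_neg φ _))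
      (fun a b c => ?_) hφ,
    (veeBilin K).compr₂ (φ ∘ₗ f₁ ∘ₗ TensorProduct.mk K _ _ (wedgeBilin K e 1)),
    fun x y => congrArg φ (F_symm e 1 x y),
    fun x y w => congrArg φ ((F_cycle e 1 x y w).trans (F_symm _ _ _ _)),
    ⟨(wedgeBilin K).compr₂ (φ ∘ₗ f₂ ∘ₗ TensorProduct.mk K _ _ e), fun x => ?_, fun x y w => ?_⟩,
    x₀, y₀, w₀, hφ⟩
  · have h1 := congrArg φ (F_cyc a b c x₀ y₀ w₀)
    rwa [map_add, map_add] at h1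
  · simp [wedgeBilin_self]
  · have h1 := congrArg φ (FG_one e x y w)
    simp only [F, G, TensorProduct.tmul_add, map_add, map_zero] at h1
    simp only [LinearMap.compr₂_apply, LinearMap.comp_apply, TensorProduct.mk_apply]
    linear_combination h1

/-- The map `A ⊗ A → Ω¹(A)`, `a ⊗ b ↦ a db - b da`. -/
noncomputable def skewDifferential : A ⊗[K] A →ₗ[K] Ω[A⁄K] :=
  TensorProduct.lift (LinearMap.mk₂ K
    (fun a b => a • KaehlerDifferential.D K A b - b • KaehlerDifferential.D K A a)
    (fun a a' b => by simp only [map_add, smul_add, add_smul]; abel)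
    (fun c a b => by simp only [Derivation.map_smul, smul_assoc, smul_comm b c, smul_sub])
    (fun a b b' => by simp only [map_add, smul_add, add_smul]; abel)
    (fun c a b => by simp only [Derivation.map_smul, smul_assoc, smul_comm a c, smul_sub]))

lemma skewDifferential_wedge (a b : A) :
    skewDifferential (K := K) (wedgeBilin K a b : A ⊗[K] A) =
      a • KaehlerDifferential.D K A b - b • KaehlerDifferential.D K A a := by
  simp only [wedgeBilin, LinearMap.mk₂_apply, wedge, skewDifferential, map_smul, map_sub,
    TensorProduct.lift.tmul]
  generalize a • KaehlerDifferential.D K A b = u, b • KaehlerDifferential.D K A a = v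
  module

lemma lift_vee {κ : k →ₗ[K] k →ₗ[K] K} (hκ : ∀ x y : k, κ x y = κ y x) (x y : k) :
    TensorProduct.lift κ (veeBilin K x y : k ⊗[K] k) = κ x y := by
  simp only [veeBilin, LinearMap.mk₂_apply, vee, map_smul, map_add, TensorProduct.lift.tmul,
    hκ y x, smul_eq_mul]
  ring

lemma lift_wedge {η : k →ₗ[K] k →ₗ[K] K} (hη : ∀ x : k, η x x = 0) (x y : k) :
    TensorProduct.lift η (wedgeBilin K x y : k ⊗[K] k) = η x y := by
  have h : η y x = -η x y := (LinearMap.IsAlt.neg (B := η) hη x y).symm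
  simp only [wedgeBilin, LinearMap.mk₂_apply, wedge, map_smul, map_sub, TensorProduct.lift.tmul,
    h, smul_eq_mul]
  ring

lemma CoupledCocycle.nonempty_of_form (hP : IsDecomposition K P) {e : A}
    (he : KaehlerDifferential.D K A e ≠ 0) {κ η : k →ₗ[K] k →ₗ[K] K}
    (hκ : ∀ x y : k, κ x y = κ y x) (hinv : ∀ x y w : k, κ ⁅x, y⁆ w = κ x ⁅y, w⁆)
    (hη : ∀ x : k, η x x = 0)
    (hcob : ∀ x y w : k, κ ⁅x, y⁆ w = -(η ⁅x, y⁆ w) - η ⁅y, w⁆ x - η ⁅w, x⁆ y)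
    {x₀ y₀ w₀ : k} (hne : κ ⁅x₀, y₀⁆ w₀ ≠ 0) : Nonempty (CoupledCocycle K A k P) := by
  let d := KaehlerDifferential.D K A
  let up : Ω[A⁄K] →ₗ[K] ULift.{max u w} Ω[A⁄K] := ULift.moduleEquiv.symm.toLinearMap
  have up_inj : Function.Injective up := ULift.moduleEquiv.symm.injective
  let g₁ : M1 K A k →ₗ[K] Ω[A⁄K] := (TensorProduct.rid K _).toLinearMap ∘ₗ
    TensorProduct.map (skewDifferential ∘ₗ (lambda2 K A).subtype)
      (TensorProduct.lift κ ∘ₗ (sym2 K k).subtype)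
  let g₂ : M2 K A k →ₗ[K] Ω[A⁄K] := -(TensorProduct.rid K _).toLinearMap ∘ₗ
    TensorProduct.map d.toLinearMap (TensorProduct.lift η ∘ₗ (lambda2 K k).subtype)
  have hg₁ (a b : A) (x y : k) : g₁ (wedgeBilin K a b ⊗ₜ veeBilin K x y) =
      κ x y • (a • d b - b • d a) := by
    rw [← skewDifferential_wedge, ← lift_vee hκ]; rfl
  have hg₂ (a : A) (x y : k) : g₂ (a ⊗ₜ wedgeBilin K x y) = -(η x y • d a) := by
    rw [← lift_wedge hη]; rfl
  have hcycle (x y w : k) : κ ⁅y, w⁆ x = κ ⁅x, y⁆ w := by rw [hinv x y w, hκ]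
  have hsum (a b c : A) (x y w : k) :
      g₁ (wedgeBilin K (a * b) c ⊗ₜ veeBilin K ⁅x, y⁆ w) +
          g₁ (wedgeBilin K (b * c) a ⊗ₜ veeBilin K ⁅y, w⁆ x) +
          g₁ (wedgeBilin K (c * a) b ⊗ₜ veeBilin K ⁅w, x⁆ y) =
        -(κ ⁅x, y⁆ w • d (a * b * c)) := by
    rw [hg₁, hg₁, hg₁, hcycle x y w, ← hcycle w x y, ← smul_add, ← smul_add, ← smul_neg]
    congr 1
    simp only [Derivation.leibniz]
    module
  refine ⟨⟨ULift.{max u w} Ω[A⁄K], up ∘ₗ g₁, up ∘ₗ g₂, ?_, fun h => ?_⟩⟩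
  · refine (hP.cocycle_iff _ _).mpr fun a b c x y w => ?_
    simp only [LinearMap.comp_apply, ← map_add up]
    rw [hsum, TensorProduct.tmul_add, TensorProduct.tmul_add, map_add g₂, map_add g₂, hg₂, hg₂, hg₂,
      hcob x y w, ← map_zero up]
    congr 1
    module
  · have h0 := hP.cocycle_iff (up ∘ₗ g₁) 0
    simp only [LinearMap.zero_apply, add_zero] at h0
    have h1 := h0.mp h e 1 1 x₀ y₀ w₀
    simp only [LinearMap.comp_apply, ← map_add up] at h1
    rw [hsum, mul_one, mul_one] at h1
    have h2 := up_inj (h1.trans (map_zero up).symm)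
    exact (smul_ne_zero hne he) (neg_eq_zero.mp h2)

end Directions

/-- `g = A ⊗ k` possesses coupled 2-cocycles if and only if
`d_A(A) ≠ {0}` and `k` possesses an invariant symmetric bilinear form `κ` for which the
Koszul 3-cocycle `Γ(κ)` is a non-zero 3-coboundary. -/
theorem statement12
    (P : ↥(lambda2 K (A ⊗[K] k)) ≃ₗ[K] Wspace K A k) (hP : IsDecomposition K P) :
    Nonempty (CoupledCocycle K A k P) ↔
      ((∃ a : A, KaehlerDifferential.D K A a ≠ 0) ∧
       ∃ κ : k →ₗ[K] k →ₗ[K] K,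
         (∀ x y : k, κ x y = κ y x) ∧
         (∀ x y w : k, κ ⁅x, y⁆ w = κ x ⁅y, w⁆) ∧
         (∃ η : k →ₗ[K] k →ₗ[K] K, (∀ x : k, η x x = 0) ∧
           ∀ x y w : k, κ ⁅x, y⁆ w = -(η ⁅x, y⁆ w) - η ⁅y, w⁆ x - η ⁅w, x⁆ y) ∧
         ∃ x y w : k, κ ⁅x, y⁆ w ≠ 0) := by
  refine ⟨fun ⟨C⟩ => C.exists_D_ne_zero_and_form hP, ?_⟩
  rintro ⟨⟨e, he⟩, κ, hκ, hinv, ⟨η, hη, hcob⟩, x, y, w, hne⟩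
  exact CoupledCocycle.nonempty_of_form hP he hκ hinv hη hcob hne

end CurrentPaper
end
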